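/- arXiv:math/0408164 — 2 statements merged into one kernel-verified Lean document; each statement's English description precedes it below -/
import Mathlib

section
/- Let λ be a completely splittable partition (i.e. λ₁ − λ_{h(λ)} + h(λ) ≤ p when λ ≠ ∅), μ any partition, A a μ-removable node, B a λ-good (in particular λ-normal) node with res A = res B (residues mod p), and suppose λ does not dominate μ. Then λ_B does not dominate μ_A. -/
open scoped Classical

/-- A partition of a natural number: a weakly decreasing, eventually zero sequence of
naturals; `part i` is the `i`-th part for `i ≥ 1` (the value `part 0` is irrelevant). -/
structure Ptn where
  part : ℕ → ℕ
  antitone : ∀ ⦃i j : ℕ⦄, 1 ≤ i → i ≤ j → part j ≤ part i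
  eventually_zero : ∃ N, ∀ i, N ≤ i → part i = 0

namespace Ptn

/-- The height of a partition: the number of (equivalently, the largest index of a)
nonzero part. -/
noncomputable def height (l : Ptn) : ℕ := sSup {i | 1 ≤ i ∧ l.part i ≠ 0}

/-- Row `i` carries a removable node `(i, λ_i)`. -/
def Removable (l : Ptn) (i : ℕ) : Prop := 1 ≤ i ∧ l.part (i + 1) < l.part i

/-- Row `i` carries an addable node `(i, λ_i + 1)`. -/
def Addable (l : Ptn) (i : ℕ) : Prop := i = 1 ∨ (2 ≤ i ∧ l.part i < l.part (i - 1))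

/-- Residue mod `p` of the removable node in row `i`, namely `λ_i - i  (mod p)`. -/
def remRes (p : ℕ) (l : Ptn) (i : ℕ) : ZMod p := (((l.part i : ℤ) - (i : ℤ) : ℤ) : ZMod p)

/-- Residue mod `p` of the addable node in row `i`, namely `λ_i + 1 - i  (mod p)`. -/
def addRes (p : ℕ) (l : Ptn) (i : ℕ) : ZMod p :=
  (((l.part i : ℤ) + 1 - (i : ℤ) : ℤ) : ZMod p)

/-- The removable node in row `r` is normal (signature rule): for every `u < r` the
number of addable nodes of the same residue in rows `[u, r)` is at most the number of
removable nodes of the same residue in rows `(u, r)`. -/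
def Normal (p : ℕ) (l : Ptn) (r : ℕ) : Prop :=
  l.Removable r ∧ ∀ u, 1 ≤ u → u < r →
    ((Finset.Ico u r).filter (fun i => l.Addable i ∧ l.addRes p i = l.remRes p r)).card ≤
    ((Finset.Ioo u r).filter (fun i => l.Removable i ∧ l.remRes p i = l.remRes p r)).card

/-- A good node is the highest normal node of its residue. -/
def Good (p : ℕ) (l : Ptn) (r : ℕ) : Prop :=
  l.Normal p r ∧ ∀ r', l.Normal p r' → l.remRes p r' = l.remRes p r → r ≤ r'

end Ptn

/-- Dominance order on part-functions: all partial sums of `f` dominate those of `g`. -/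
def Dominates (f g : ℕ → ℕ) : Prop :=
  ∀ i, ∑ j ∈ Finset.Icc 1 i, g j ≤ ∑ j ∈ Finset.Icc 1 i, f j

/-- Remove one node from row `r`. -/
def removeAt (f : ℕ → ℕ) (r : ℕ) : ℕ → ℕ := fun i => if i = r then f i - 1 else f i

/-- The canonical beta-set of a partition: `n` is a bead iff `n = λ_i - i` for some `i ≥ 1`. -/
def Beta (l : Ptn) (n : ℤ) : Prop := ∃ i : ℕ, 1 ≤ i ∧ (l.part i : ℤ) - (i : ℤ) = n

/-- `m` is obtained from `l` by removing one rim `p`-hook (moving a bead of the canonical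
beta-set up by `p`). -/
def RemoveHook (p : ℕ) (l m : Ptn) : Prop :=
  ∃ a : ℤ, Beta l a ∧ ¬ Beta l (a - p) ∧
    ∀ n : ℤ, Beta m n ↔ (n ≠ a ∧ (n = a - (p : ℤ) ∨ Beta l n))

/-- A partition with no rim `p`-hook. -/
def IsPCore (p : ℕ) (c : Ptn) : Prop := ¬ ∃ m, RemoveHook p c m

/-- `c` is the `p`-core of `l`. -/
def PCore (p : ℕ) (l c : Ptn) : Prop :=
  Relation.ReflTransGen (RemoveHook p) l c ∧ IsPCore p c

/-- The `p`-core of `l` is empty. -/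
def EmptyCore (p : ℕ) (l : Ptn) : Prop :=
  ∃ c : Ptn, PCore p l c ∧ ∀ i, 1 ≤ i → c.part i = 0

/-- An abacus: eventually beads (`true`) to the left and spaces (`false`) to the right. -/
structure Abacus where
  f : ℤ → Bool
  low : ∃ N : ℤ, ∀ n, n ≤ N → f n = true
  high : ∃ N : ℤ, ∀ n, N ≤ n → f n = false

/-- The abacus `Λ` displays the part-function `l`: if `a 1 > a 2 > ⋯` enumerates the
beads of `Λ`, then `l i` is the number of spaces below the `i`-th bead. -/
def Displays (Λ : Abacus) (l : ℕ → ℕ) : Prop :=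
  ∃ a : ℕ → ℤ,
    (∀ i, 1 ≤ i → a (i + 1) < a i) ∧
    (∀ n : ℤ, Λ.f n = true ↔ ∃ i, 1 ≤ i ∧ a i = n) ∧
    (∀ i, 1 ≤ i → l i = Set.ncard {n : ℤ | n ≤ a i ∧ Λ.f n = false})

theorem sum_removeAt (f : ℕ → ℕ) (r : ℕ) (h1 : 1 ≤ r) (hf : 1 ≤ f r) (i : ℕ) :
    ∑ j ∈ Finset.Icc 1 i, removeAt f r j + (if r ≤ i then 1 else 0) =
      ∑ j ∈ Finset.Icc 1 i, f j := by
  induction i with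
  | zero => simp; omega
  | succ k ih =>
    rw [Finset.sum_Icc_succ_top (by omega), Finset.sum_Icc_succ_top (by omega), ← ih]
    unfold removeAt
    by_cases h : k + 1 = r
    · subst h
      simp
      omega
    · by_cases h2 : r ≤ k
      · simp [h, h2, Nat.le_succ_of_le h2]; omega
      · have : ¬ r ≤ k + 1 := by omega
        simp [h, h2, this]

theorem res_le (p : ℕ) (x y : ℤ) (h : (x : ZMod p) = (y : ZMod p)) (hlt : y < x) :
    y + p ≤ x := by
  rw [ZMod.intCast_eq_intCast_iff_dvd_sub] at h
  have h2 : (p : ℤ) ∣ x - y := by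
    rw [← neg_sub]; exact (dvd_neg).2 h
  have := Int.le_of_dvd (by omega) h2
  omega

/-- If `λ` is completely splittable (`λ₁ - λ_{h(λ)} + h(λ) ≤ p`), `A` is a `μ`-removable
node, `B` a `λ`-good node of the same residue, and `λ` does not dominate `μ`, then `λ_B`
does not dominate `μ_A`. -/
theorem stmt5 (p : ℕ) (hp : 0 < p) (l m : Ptn)
    (hcs : l.part 1 + l.height ≤ p + l.part l.height)
    (A B : ℕ) (hA : m.Removable A) (hB : l.Good p B)
    (hres : m.remRes p A = l.remRes p B)
    (hdom : ¬ Dominates l.part m.part) :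
    ¬ Dominates (removeAt l.part B) (removeAt m.part A) := by
  intro hD
  unfold Dominates at hdom
  push Not at hdom
  obtain ⟨i, hi⟩ := hdom
  obtain ⟨hA1, hA2⟩ := hA
  obtain ⟨⟨⟨hB1, hB2⟩, hN⟩, -⟩ := hB
  have key : ∀ k, ∑ j ∈ Finset.Icc 1 k, m.part j + (if B ≤ k then 1 else 0) ≤
      ∑ j ∈ Finset.Icc 1 k, l.part j + (if A ≤ k then 1 else 0) := by
    intro k
    have h1 := sum_removeAt l.part B hB1 (by omega) k
    have h2 := sum_removeAt m.part A hA1 (by omega) k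
    have h3 := hD k
    omega
  have ki := key i
  have hAi : A ≤ i := by
    by_contra h
    rw [if_neg h] at ki
    omega
  have hiB : i < B := by
    by_contra h
    rw [if_pos hAi, if_pos (by omega)] at ki
    omega
  -- `m_i ≥ l_i`
  have hmi : l.part i ≤ m.part i := by
    obtain ⟨k, rfl⟩ : ∃ k, i = k + 1 := ⟨i - 1, by omega⟩
    have kk := key k
    rw [if_neg (by omega : ¬ B ≤ k)] at kk
    rw [Finset.sum_Icc_succ_top (by omega), Finset.sum_Icc_succ_top (by omega)] at hi
    split_ifs at kk <;> omega
  have e1 := m.antitone hA1 hAi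
  have e2 := l.antitone (by omega : 1 ≤ i) hiB.le
  have hbig := res_le p _ _ hres (by omega)
  -- height
  have hbdd : BddAbove {i | 1 ≤ i ∧ l.part i ≠ 0} := by
    obtain ⟨N, hN⟩ := l.eventually_zero
    refine ⟨N, fun x hx => ?_⟩
    by_contra h
    exact hx.2 (hN x (by omega))
  have hBh : B ≤ l.height := le_csSup hbdd ⟨hB1, by omega⟩
  have e3 := l.antitone hB1 hBh
  have hstrict : l.part 1 + B < p + l.part B := by
    by_contra hns
    have heq : l.part 1 + B = p + l.part B := by omega
    have hn := hN 1 le_rfl (by omega)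
    have hpos : 0 < ((Finset.Ico 1 B).filter
        (fun i => l.Addable i ∧ l.addRes p i = l.remRes p B)).card := by
      rw [Finset.card_pos]
      refine ⟨1, Finset.mem_filter.2 ⟨Finset.mem_Ico.2 ⟨le_rfl, by omega⟩, Or.inl rfl, ?_⟩⟩
      unfold Ptn.addRes Ptn.remRes
      have : (l.part 1 : ℤ) + 1 - ((1 : ℕ) : ℤ) = (l.part B - B) + (p : ℤ) := by
        push_cast; omega
      rw [this]
      push_cast
      simp
    obtain ⟨k, hk⟩ := Finset.card_pos.1 (lt_of_lt_of_le hpos hn)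
    obtain ⟨hk1, -, hk2⟩ := Finset.mem_filter.1 hk
    obtain ⟨hk3, hk4⟩ := Finset.mem_Ioo.1 hk1
    have f1 := l.antitone (by omega : 1 ≤ k) hk4.le
    have f2 := l.antitone le_rfl hk3.le
    have := res_le p _ _ hk2 (by omega)
    omega
  have hlow : A * m.part A ≤ ∑ j ∈ Finset.Icc 1 A, m.part j := by
    have := Finset.card_nsmul_le_sum (Finset.Icc 1 A) m.part (m.part A)
      (fun x hx => m.antitone (Finset.mem_Icc.1 hx).1 (Finset.mem_Icc.1 hx).2)
    simpa using this
  have hup : ∑ j ∈ Finset.Icc 1 A, l.part j ≤ A * l.part 1 := by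
    have := Finset.sum_le_card_nsmul (Finset.Icc 1 A) l.part (l.part 1)
      (fun x hx => l.antitone le_rfl (Finset.mem_Icc.1 hx).1)
    simpa using this
  have kA := key A
  rw [if_pos le_rfl, if_neg (by omega : ¬ B ≤ A)] at kA
  have hm : l.part 1 + 2 ≤ m.part A := by omega
  have := Nat.mul_le_mul_left A hm
  rw [Nat.mul_add] at this
  omega
end

section
/- For any partition λ and any residue α ∈ ℤ/pℤ, the number of normal nodes of residue α of the p-core of λ does not exceed the number of normal nodes of residue α of λ. -/
open scoped Classical

def bt (l : Ptn) (i : ℕ) : ℤ := (l.part i : ℤ) - (i : ℤ)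

lemma bt_lt (l : Ptn) {i j : ℕ} (hi : 1 ≤ i) (h : i < j) : bt l j < bt l i := by
  have := l.antitone hi h.le
  unfold bt; omega

lemma lt_of_bt (l : Ptn) {i j : ℕ} (hj : 1 ≤ j) (h : bt l j < bt l i) : i < j := by
  by_contra hc
  rcases Nat.lt_or_ge j i with h' | h'
  · have := bt_lt l hj h'; omega
  · have : i = j := by omega
    subst this; omega

lemma bt_inj (l : Ptn) {i j : ℕ} (hi : 1 ≤ i) (hj : 1 ≤ j) (h : bt l i = bt l j) : i = j := by
  rcases lt_trichotomy i j with h' | h' | h'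
  · have := bt_lt l hi h'; omega
  · exact h'
  · have := bt_lt l hj h'; omega

lemma beta_bt (l : Ptn) {i : ℕ} (hi : 1 ≤ i) : Beta l (bt l i) := ⟨i, hi, rfl⟩

lemma rem_not_beta (l : Ptn) {r : ℕ} (h : l.Removable r) : ¬ Beta l (bt l r - 1) := by
  rintro ⟨i, hi, e⟩
  change bt l i = _ at e
  have h1 : r < i := lt_of_bt l hi (by omega)
  have h2 : bt l i ≤ bt l (r + 1) := by
    rcases Nat.lt_or_ge (r+1) i with h' | h'
    · exact (bt_lt l (by omega) h').le
    · have : i = r + 1 := by omega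
      rw [this]
  have := h.2
  unfold bt at *
  push_cast at *
  omega

lemma addable_pos (l : Ptn) {r : ℕ} (h : l.Addable r) : 1 ≤ r := by
  rcases h with h | h <;> omega

lemma add_not_beta (l : Ptn) {r : ℕ} (h : l.Addable r) : ¬ Beta l (bt l r + 1) := by
  rintro ⟨i, hi, e⟩
  change bt l i = _ at e
  have h1 : i < r := lt_of_bt l (addable_pos l h) (by omega)
  rcases h with h | ⟨h2, h3⟩
  · omega
  have h2 : bt l (r - 1) ≤ bt l i := by
    rcases Nat.lt_or_ge i (r-1) with h' | h'
    · exact (bt_lt l (by omega) h').le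
    · have : i = r - 1 := by omega
      rw [this]
  unfold bt at *
  have : ((r - 1 : ℕ) : ℤ) = r - 1 := by omega
  omega

lemma core_closed (p : ℕ) (c : Ptn) (h : IsPCore p c) (a : ℤ) (ha : Beta c a) :
    Beta c (a - p) := by
  by_contra hb
  apply h
  obtain ⟨i, hi, e⟩ := id ha
  change bt c i = a at e
  have hex : ∃ k : ℕ, bt c (k + 1) < a - p := by
    obtain ⟨N, hN⟩ := c.eventually_zero
    refine ⟨N + (a - p).natAbs, ?_⟩
    have := hN (N + (a - p).natAbs + 1) (by omega)
    unfold bt; rw [this, Nat.cast_add, Nat.cast_add, Int.natCast_natAbs]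
    have := neg_abs_le (a - (p : ℤ)); push_cast; omega
  obtain ⟨j, hj, hmin⟩ : ∃ j : ℕ, bt c (j + 1) < a - p ∧ ∀ k < j, ¬ bt c (k + 1) < a - p :=
    ⟨Nat.find hex, Nat.find_spec hex, fun k hk => Nat.find_min hex hk⟩
  have hij : i < j + 1 := lt_of_bt c (by omega) (by omega)
  have hgt : ∀ k, 1 ≤ k → k ≤ j → a - p < bt c k := by
    intro k hk hkj
    have h1 := hmin (k - 1) (by omega)
    rw [Nat.sub_add_cancel hk] at h1
    have h2 : bt c k ≠ a - p := fun h => hb (h ▸ beta_bt c hk)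
    omega
  have hq : 0 ≤ a - p + j := by
    unfold bt at hj; push_cast at hj; omega
  have hP : ∀ k, 1 ≤ k → k ≤ j → (a - p + j : ℤ) + 1 ≤ c.part k := by
    intro k hk hkj
    have h1 := hgt j (by omega) le_rfl
    have h2 := c.antitone hk hkj
    unfold bt at h1; omega
  have hQ : (c.part (j+1) : ℤ) ≤ a - p + j := by
    unfold bt at hj; push_cast at hj; omega
  let f : ℕ → ℕ := fun k => if k < i then c.part k else if k < j then c.part (k+1) - 1
    else if k = j then (a - p + j).toNat else c.part k
  have hstep : ∀ k, 1 ≤ k → f (k+1) ≤ f k := by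
    intro k hk
    have a1 := c.antitone hk (Nat.le_succ k)
    have a2 := c.antitone (Nat.le_succ_of_le hk) (Nat.le_succ (k+1))
    simp only [Nat.succ_eq_add_one] at a1 a2
    have p1 := hP k hk
    have p2 := hP (k+1) (by omega)
    simp only [f]
    rcases eq_or_ne k j with rfl | hkj
    · split_ifs <;> omega
    · split_ifs <;> omega
  let m : Ptn := ⟨f, by
    intro x y hx hxy
    induction y, hxy using Nat.le_induction with
    | base => exact le_rfl
    | succ y hy ih => exact (hstep y (by omega)).trans ih, by
    obtain ⟨N, hN⟩ := c.eventually_zero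
    refine ⟨N + j + 1, fun k hk => ?_⟩
    have := hN k (by omega)
    simp only [f]
    split_ifs <;> omega⟩
  have m1 : ∀ k, k < i → bt m k = bt c k := by
    intro k hk; simp [bt, m, f, hk]
  have m2 : ∀ k, i ≤ k → k < j → bt m k = bt c (k+1) := by
    intro k hk hkj
    have := hP (k+1) (by omega) (by omega)
    simp only [bt, m, f]
    rw [if_neg (by omega), if_pos hkj]
    push_cast; omega
  have m3 : bt m j = a - p := by
    simp only [bt, m, f]
    rw [if_neg (by omega), if_neg (by omega)]; simp only [if_true]
    omega
  have m4 : ∀ k, j < k → bt m k = bt c k := by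
    intro k hk
    simp only [bt, m, f]
    rw [if_neg (by omega), if_neg (by omega), if_neg (by omega)]
  refine ⟨m, a, ha, hb, fun n => ⟨?_, ?_⟩⟩
  · rintro ⟨k, hk, e'⟩
    change bt m k = n at e'
    have key : ∀ q, 1 ≤ q → q ≠ i → bt c q = n → n ≠ a ∧ (n = a - (p : ℤ) ∨ Beta c n) := by
      intro q hq hqi hn
      refine ⟨fun h => hqi (bt_inj c hq hi (by omega)), Or.inr ⟨q, hq, hn⟩⟩
    rcases Nat.lt_or_ge k i with h1 | h1
    · exact key k hk (by omega) (by rw [← m1 k h1]; exact e')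
    rcases lt_trichotomy k j with h2 | h2 | h2
    · exact key (k+1) (by omega) (by omega) (by rw [← m2 k h1 h2]; exact e')
    · subst h2
      have : n = a - p := by omega
      refine ⟨?_, Or.inl this⟩
      intro h
      apply hb
      rw [← this, h]; exact ha
    · exact key k hk (by omega) (by rw [← m4 k h2]; exact e')
  · rintro ⟨hna, rfl | ⟨k, hk, e'⟩⟩
    · exact ⟨j, by omega, m3⟩
    change bt c k = n at e'
    have hki : k ≠ i := by rintro rfl; omega
    rcases Nat.lt_or_ge k i with h1 | h1
    · exact ⟨k, hk, (m1 k h1).trans e'⟩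
    rcases Nat.lt_or_ge j k with h2 | h2
    · exact ⟨k, hk, (m4 k h2).trans e'⟩
    · refine ⟨k - 1, by omega, (m2 (k-1) (by omega) (by omega)).trans ?_⟩
      rw [Nat.sub_add_cancel hk]; exact e'

lemma closed_iter (p : ℕ) (c : Ptn) (h : IsPCore p c) (t : ℕ) (a : ℤ) (ha : Beta c a) :
    Beta c (a - p * t) := by
  induction t with
  | zero => simpa using ha
  | succ t ih =>
    have := core_closed p c h _ ih
    convert this using 1
    push_cast; ring

lemma core_no_add (p : ℕ) (c : Ptn) (h : IsPCore p c) (r i : ℕ) (hr : c.Removable r)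
    (hi : c.Addable i) (e : c.addRes p i = c.remRes p r) : False := by
  have h1 := rem_not_beta c hr
  have h2 := add_not_beta c hi
  have e' : ((bt c i + 1 : ℤ) : ZMod p) = ((bt c r : ℤ) : ZMod p) := by
    rw [← show c.remRes p r = ((bt c r : ℤ) : ZMod p) from rfl, ← e]
    unfold Ptn.addRes bt
    congr 1; ring
  rw [ZMod.intCast_eq_intCast_iff_dvd_sub] at e'
  obtain ⟨t, ht⟩ := e'
  rcases le_total 0 t with h0 | h0
  · lift t to ℕ using h0
    apply h2
    have := closed_iter p c h t _ (beta_bt c hr.1)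
    convert this using 1
    linarith
  · obtain ⟨s, rfl⟩ : ∃ s : ℕ, t = -(s : ℤ) := ⟨t.natAbs, by omega⟩
    apply h1
    have := closed_iter p c h s _ (beta_bt c (addable_pos c hi))
    convert this using 1
    linarith

noncomputable def RR (p : ℕ) (l : Ptn) (α : ZMod p) (K : ℕ) : ℕ :=
  ((Finset.Icc 1 K).filter (fun i => l.Removable i ∧ l.remRes p i = α)).card
noncomputable def AA (p : ℕ) (l : Ptn) (α : ZMod p) (K : ℕ) : ℕ :=
  ((Finset.Icc 1 K).filter (fun i => l.Addable i ∧ l.addRes p i = α)).card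
noncomputable def NN (p : ℕ) (l : Ptn) (α : ZMod p) (K : ℕ) : ℕ :=
  ((Finset.Icc 1 K).filter (fun i => l.Normal p i ∧ l.remRes p i = α)).card
noncomputable def TT (p : ℕ) (l : Ptn) (α : ZMod p) (K : ℕ) : ℕ :=
  ((Finset.Icc 1 K).filter (fun i => l.remRes p i = α)).card
noncomputable def SS (p : ℕ) (l : Ptn) (α : ZMod p) (L U : ℤ) : ℕ :=
  ((Finset.Icc L U).filter (fun n => Beta l n ∧ (n : ZMod p) = α)).card

lemma card_succ (P : ℕ → Prop) [DecidablePred P] (K : ℕ) : ((Finset.Icc 1 (K+1)).filter P).card =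
    ((Finset.Icc 1 K).filter P).card + if P (K+1) then 1 else 0 := by
  rw [← Finset.insert_Icc_right_eq_Icc_add_one (by omega), Finset.filter_insert]
  split_ifs with h
  · rw [Finset.card_insert_of_notMem (by simp)]
  · rfl

lemma card_split (P : ℕ → Prop) [DecidablePred P] (u k : ℕ) (h : u ≤ k) : ((Finset.Icc 1 k).filter P).card =
    ((Finset.Icc 1 u).filter P).card + ((Finset.Ioc u k).filter P).card := by
  rw [← Finset.card_union_of_disjoint, ← Finset.filter_union]
  · congr 2; ext x; simp; omega
  · apply Finset.disjoint_filter_filter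
    rw [Finset.disjoint_left]; intro x; simp; omega

lemma RR_succ (p : ℕ) (l : Ptn) (α : ZMod p) (k : ℕ) : RR p l α (k+1) =
    RR p l α k + if (l.Removable (k+1) ∧ l.remRes p (k+1) = α) then 1 else 0 := by
  unfold RR; rw [card_succ]
lemma AA_succ (p : ℕ) (l : Ptn) (α : ZMod p) (k : ℕ) : AA p l α (k+1) =
    AA p l α k + if (l.Addable (k+1) ∧ l.addRes p (k+1) = α) then 1 else 0 := by
  unfold AA; rw [card_succ]
lemma NN_succ (p : ℕ) (l : Ptn) (α : ZMod p) (k : ℕ) : NN p l α (k+1) =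
    NN p l α k + if (l.Normal p (k+1) ∧ l.remRes p (k+1) = α) then 1 else 0 := by
  unfold NN; rw [card_succ]
lemma TT_succ (p : ℕ) (l : Ptn) (α : ZMod p) (k : ℕ) : TT p l α (k+1) =
    TT p l α k + if l.remRes p (k+1) = α then 1 else 0 := by
  unfold TT; rw [card_succ]

lemma RA_eq (p : ℕ) (l : Ptn) (α : ZMod p) (K : ℕ) :
    (RR p l α (K+1) : ℤ) - AA p l α (K+1) = TT p l α (K+1) - TT p l (α - 1) (K+1)
      - if (l.part (K+1) = l.part (K+2) ∧ l.remRes p (K+1) = α) then 1 else 0 := by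
  have hadd : ∀ i, l.addRes p i = α ↔ l.remRes p i = α - 1 := by
    intro i
    unfold Ptn.addRes Ptn.remRes
    rw [eq_sub_iff_add_eq]
    push_cast
    constructor <;> intro h <;> rw [← h] <;> ring
  induction K with
  | zero =>
    have a1 := l.antitone (i := 1) (j := 2) (by omega) (by omega)
    rw [RR_succ, AA_succ, TT_succ, TT_succ]
    have z1 : RR p l α 0 = 0 := by simp [RR]
    have z2 : AA p l α 0 = 0 := by simp [AA]
    have z3 : ∀ α, TT p l α 0 = 0 := by simp [TT]
    simp only [z1, z2, z3, hadd, Ptn.Removable, Ptn.Addable]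
    by_cases h1 : l.remRes p 1 = α <;> by_cases h2 : l.remRes p 1 = α - 1 <;>
      rcases a1.lt_or_eq with h3 | h3 <;> simp [h1, h2, h3] <;> omega
  | succ K ih =>
    have a0 := l.antitone (i := K+1) (j := K+1+1) (by omega) (by omega)
    have a1 := l.antitone (i := K+1+1) (j := K+1+1+1) (by omega) (by omega)
    have hs : l.part (K+1) = l.part (K+1+1) →
        (l.remRes p (K+1) = α ↔ l.remRes p (K+1+1) = α - 1) := by
      intro h
      unfold Ptn.remRes
      rw [h, eq_sub_iff_add_eq]
      push_cast
      constructor <;> intro h <;> rw [← h] <;> ring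
    have r1 : l.Removable (K+1+1) ↔ l.part (K+1+1+1) ≠ l.part (K+1+1) := by
      unfold Ptn.Removable; omega
    have r2 : l.Addable (K+1+1) ↔ l.part (K+1) ≠ l.part (K+1+1) := by
      unfold Ptn.Addable
      simp only [Nat.add_sub_cancel]; omega
    rw [RR_succ p l α (K+1), AA_succ p l α (K+1), TT_succ p l α (K+1), TT_succ p l (α-1) (K+1)]
    simp only [hadd, r1, r2, show K + 1 + 2 = K+1+1+1 from rfl, show K + 2 = K+1+1 from rfl] at ih ⊢
    push_cast
    clear r1 r2 hadd
    generalize l.remRes p (K+1+1) = x at *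
    generalize l.remRes p (K+1) = y at *
    generalize α - 1 = γ at *
    grind

lemma TT_eq (p : ℕ) (l : Ptn) (α : ZMod p) (N K : ℕ) (hN : ∀ i, N ≤ i → l.part i = 0)
    (hK : N ≤ K) (U : ℤ) (hU : l.part 1 ≤ U) : TT p l α K = SS p l α (-K) U := by
  unfold TT SS
  apply Finset.card_bij (fun i _ => bt l i)
  · intro i hi
    simp only [Finset.mem_filter, Finset.mem_Icc] at hi ⊢
    have := l.antitone le_rfl hi.1.1
    refine ⟨⟨?_, ?_⟩, beta_bt l hi.1.1, hi.2⟩ <;> unfold bt <;> omega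
  · intro i hi j hj h
    simp only [Finset.mem_filter, Finset.mem_Icc] at hi hj
    exact bt_inj l hi.1.1 hj.1.1 h
  · intro n hn
    simp only [Finset.mem_filter, Finset.mem_Icc] at hn
    obtain ⟨⟨h1, h2⟩, ⟨i, hi, e⟩, h3⟩ := hn
    refine ⟨i, ?_, e⟩
    simp only [Finset.mem_filter, Finset.mem_Icc]
    refine ⟨⟨hi, ?_⟩, ?_⟩
    · by_contra hc
      have := hN i (by omega)
      omega
    · rw [← h3, ← e]; rfl

lemma SS_hook (p : ℕ) (l m : Ptn) (h : RemoveHook p l m) :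
    ∃ M : ℤ, ∀ L U : ℤ, L ≤ -M → M ≤ U → ∀ α, SS p l α L U = SS p m α L U := by
  obtain ⟨a, ha, hb, hm⟩ := h
  refine ⟨|a| + p, fun L U hL hU α => ?_⟩
  have b1 := le_abs_self a
  have b2 := neg_abs_le a
  have hne : a - p ≠ a := by intro h; rw [h] at hb; exact hb ha
  have hz : ((a - p : ℤ) : ZMod p) = a := by push_cast; simp
  unfold SS
  by_cases hα : (a : ZMod p) = α
  · have : (Finset.Icc L U).filter (fun n => Beta m n ∧ (n : ZMod p) = α) =
        insert (a - p) (((Finset.Icc L U).filter (fun n => Beta l n ∧ (n : ZMod p) = α)).erase a) := by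
      ext n
      simp only [Finset.mem_filter, Finset.mem_insert, Finset.mem_erase, Finset.mem_Icc, hm]
      constructor
      · rintro ⟨h1, ⟨h2, h3 | h3⟩, h4⟩
        · exact Or.inl h3
        · exact Or.inr ⟨h2, h1, h3, h4⟩
      · rintro (rfl | ⟨h2, h1, h3, h4⟩)
        · exact ⟨⟨by omega, by omega⟩, ⟨hne, Or.inl rfl⟩, hz.trans hα⟩
        · exact ⟨h1, ⟨h2, Or.inr h3⟩, h4⟩
    rw [this, Finset.card_insert_of_notMem, Finset.card_erase_add_one]
    · simp only [Finset.mem_filter, Finset.mem_Icc]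
      exact ⟨⟨by omega, by omega⟩, ha, hα⟩
    · simp [hb]
  · congr 1
    ext n
    simp only [Finset.mem_filter, hm]
    constructor
    · rintro ⟨h1, h2, h3⟩
      exact ⟨h1, ⟨by rintro rfl; exact hα h3, Or.inr h2⟩, h3⟩
    · rintro ⟨h1, ⟨h2, h3 | h3⟩, h4⟩
      · subst h3; exact absurd (hz.symm.trans h4) hα
      · exact ⟨h1, h3, h4⟩

lemma SS_core (p : ℕ) (l m : Ptn) (h : Relation.ReflTransGen (RemoveHook p) l m) :
    ∃ M : ℤ, ∀ L U : ℤ, L ≤ -M → M ≤ U → ∀ α, SS p l α L U = SS p m α L U := by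
  induction h with
  | refl => exact ⟨0, fun _ _ _ _ _ => rfl⟩
  | tail _ h2 ih =>
    obtain ⟨M1, h1⟩ := ih
    obtain ⟨M2, h2⟩ := SS_hook p _ _ h2
    refine ⟨max M1 M2, fun L U hL hU α => ?_⟩
    have := le_max_left M1 M2
    have := le_max_right M1 M2
    rw [h1 L U (by omega) (by omega) α, h2 L U (by omega) (by omega) α]

lemma NN_ge (p : ℕ) (hp : p ≠ 1) (l : Ptn) (α : ZMod p) (k : ℕ) :
    ∀ j ≤ k, RR p l α j ≤ NN p l α k + AA p l α j := by
  induction k with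
  | zero =>
    intro j hj
    have : j = 0 := by omega
    subst this; simp [RR]
  | succ k ih =>
    have hNs : NN p l α (k+1) = NN p l α k + if (l.Normal p (k+1) ∧ l.remRes p (k+1) = α) then 1 else 0 :=
      NN_succ p l α k
    have hRs : ∀ k, RR p l α (k+1) = RR p l α k + if (l.Removable (k+1) ∧ l.remRes p (k+1) = α) then 1 else 0 :=
      RR_succ p l α
    have hAs : ∀ k, AA p l α (k+1) = AA p l α k + if (l.Addable (k+1) ∧ l.addRes p (k+1) = α) then 1 else 0 :=
      AA_succ p l α
    intro j hj
    rcases Nat.lt_or_ge j (k+1) with h | h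
    · have := ih j (by omega)
      omega
    have : j = k + 1 := by omega
    subst this
    by_cases hrec : ∃ j ≤ k, RR p l α (k+1) + AA p l α j ≤ RR p l α j + AA p l α (k+1)
    · obtain ⟨j, hj, h⟩ := hrec
      have := ih j hj
      omega
    push Not at hrec
    have hk := hrec k le_rfl
    have hR : l.Removable (k+1) ∧ l.remRes p (k+1) = α := by
      by_contra hc
      have := hRs k
      have := hAs k
      rw [if_neg hc] at *
      omega
    have hnorm : l.Normal p (k+1) := by
      refine ⟨hR.1, fun u hu huk => ?_⟩
      rw [hR.2]
      have eR : RR p l α k = RR p l α u + ((Finset.Ioc u k).filter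
          (fun i => l.Removable i ∧ l.remRes p i = α)).card := by
        unfold RR; exact card_split _ u k (by omega)
      have eA : AA p l α k = AA p l α (u-1) + ((Finset.Ioc (u-1) k).filter
          (fun i => l.Addable i ∧ l.addRes p i = α)).card := by
        unfold AA; exact card_split _ (u-1) k (by omega)
      have s1 : Finset.Ico u (k+1) = Finset.Ioc (u-1) k := by ext x; simp; omega
      have s2 : Finset.Ioo u (k+1) = Finset.Ioc u k := by ext x; simp only [Finset.mem_Ioo, Finset.mem_Ioc]; omega
      rw [s1, s2]
      have f1 := hrec u (by omega)
      have f2 := hrec (u-1) (by omega)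
      have f3 := hRs (u-1)
      have f4 := hAs (u-1)
      rw [Nat.sub_add_cancel hu] at f3 f4
      have f5 := hRs k
      have f6 := hAs k
      rw [if_pos hR] at f5
      by_cases c1 : l.Removable u ∧ l.remRes p u = α
      · have c2 : ¬ (l.Addable u ∧ l.addRes p u = α) := by
          rintro ⟨-, h⟩
          have := c1.2.trans h.symm
          unfold Ptn.addRes Ptn.remRes at this
          rw [ZMod.intCast_eq_intCast_iff_dvd_sub] at this
          have h1 : (p : ℤ) ∣ 1 := by convert this using 1; ring
          apply hp
          exact Nat.dvd_one.1 (by exact_mod_cast h1)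
        rw [if_neg c2] at f4
        omega
      · rw [if_neg c1] at f3
        omega
    rw [if_pos ⟨hnorm, hR.2⟩] at hNs
    have := ih k le_rfl
    have := hRs k
    have := hAs k
    rw [if_pos hR] at *
    omega

lemma ncard_NN (p : ℕ) (l : Ptn) (α : ZMod p) (N K : ℕ) (hN : ∀ i, N ≤ i → l.part i = 0)
    (hK : N ≤ K) : Set.ncard {r : ℕ | l.Normal p r ∧ l.remRes p r = α} = NN p l α K := by
  unfold NN
  rw [← Set.ncard_coe_finset]
  congr 1
  ext r
  simp only [Set.mem_ofPred_eq, Finset.coe_filter, Finset.mem_Icc]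
  constructor
  · intro h
    have h1 := h.1.1
    refine ⟨⟨h1.1, ?_⟩, h⟩
    by_contra hc
    have := hN r (by omega)
    have := h1.2
    omega
  · exact fun h => h.2

/-- For any partition `λ` and residue `α`, the number of normal nodes of residue `α` of
the `p`-core of `λ` does not exceed that of `λ`. -/
theorem stmt12 (p : ℕ) (hp : 0 < p) (l c : Ptn) (hc : PCore p l c) (α : ZMod p) :
    Set.ncard {r : ℕ | c.Normal p r ∧ c.remRes p r = α} ≤
    Set.ncard {r : ℕ | l.Normal p r ∧ l.remRes p r = α} := by
  obtain ⟨h1, hcore⟩ := hc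
  obtain ⟨N1, hN1⟩ := l.eventually_zero
  obtain ⟨N2, hN2⟩ := c.eventually_zero
  obtain ⟨M, hM⟩ := SS_core p l c h1
  obtain ⟨K, hK⟩ : ∃ K : ℕ, K = N1 + N2 + M.natAbs := ⟨_, rfl⟩
  rw [ncard_NN p c α N2 (K+1) hN2 (by omega), ncard_NN p l α N1 (K+1) hN1 (by omega)]
  by_cases hex : ∃ r, c.Removable r ∧ c.remRes p r = α
  swap
  · have : NN p c α (K+1) = 0 := by
      unfold NN
      rw [Finset.card_eq_zero, Finset.filter_eq_empty_iff]
      intro r _ h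
      exact hex ⟨r, h.1.1, h.2⟩
    omega
  obtain ⟨r, hr, hrα⟩ := hex
  have hp1 : p ≠ 1 := by
    rintro rfl
    have := core_closed 1 c hcore _ (beta_bt c hr.1)
    exact rem_not_beta c hr (by simpa using this)
  have hA : AA p c α (K+1) = 0 := by
    unfold AA
    rw [Finset.card_eq_zero, Finset.filter_eq_empty_iff]
    intro i _ h
    exact core_no_add p c hcore r i hr h.1 (h.2.trans hrα.symm)
  have hNR : NN p c α (K+1) ≤ RR p c α (K+1) := by
    unfold NN RR
    apply Finset.card_le_card
    intro i hi
    simp only [Finset.mem_filter] at hi ⊢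
    exact ⟨hi.1, hi.2.1.1, hi.2.2⟩
  have hge := NN_ge p hp1 l α (K+1) (K+1) le_rfl
  have e1 := RA_eq p l α K
  have e2 := RA_eq p c α K
  have hT : ∀ β, TT p l β (K+1) = TT p c β (K+1) := by
    intro β
    rw [TT_eq p l β N1 (K+1) hN1 (by omega) (l.part 1 + c.part 1 + M.natAbs) (by omega),
      TT_eq p c β N2 (K+1) hN2 (by omega) (l.part 1 + c.part 1 + M.natAbs) (by omega)]
    exact hM _ _ (by omega) (by omega) β
  have z1 := hN1 (K+1) (by omega)
  have z2 := hN2 (K+1) (by omega)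
  have z3 := hN1 (K+2) (by omega)
  have z4 := hN2 (K+2) (by omega)
  rw [hT, hT] at e1
  simp only [Ptn.remRes, z1, z2, z3, z4] at e1 e2
  omega
end
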